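/- arXiv:1301.0241 — 4 statements merged into one kernel-verified Lean document; each statement's English description precedes it below -/
import Mathlib

section
/- Let S and T be densely defined operators on a complex Hilbert space H such that T ⊂ S*S and T ⊂ SS*. Let D ⊆ D(T) be a dense linear subspace which is a core for S*S. If S is closed, then S is normal, i.e., S*S = SS*. -/
open LinearPMap
open scoped InnerProductSpace

variable {H : Type*} [NormedAddCommGroup H] [InnerProductSpace ℂ H] [CompleteSpace H]

/-- The product `S * T` of unbounded operators, with domain
`{x ∈ D(T) : T x ∈ D(S)}` and value `x ↦ S (T x)`. -/
noncomputable def LinearPMap.pmul (S T : H →ₗ.[ℂ] H) : H →ₗ.[ℂ] H :=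
  S.comp (T.domRestrict ((Submodule.comap T.toFun S.domain).map T.domain.subtype))
    (fun x => by
      obtain ⟨y, hy, hyx⟩ := x.2.1
      have h : T.domRestrict _ x = T y := LinearPMap.domRestrict_apply hyx.symm
      rw [h]; exact hy)

/-- A densely defined closed operator `S` is normal if `S* S = S S*`
(as operators, with equal domains). -/
structure LinearPMap.IsNormalOp (S : H →ₗ.[ℂ] H) : Prop where
  dense : Dense (S.domain : Set H)
  isClosed : S.IsClosed
  adjoint_mul_comm : S†.pmul S = S.pmul S†

namespace LinearPMap

theorem mem_graph_pmul_iff {E : Type*} [NormedAddCommGroup E] [InnerProductSpace ℂ E]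
    {S T : E →ₗ.[ℂ] E} {x y : E} :
    (x, y) ∈ (S.pmul T).graph ↔ ∃ z, (x, z) ∈ T.graph ∧ (z, y) ∈ S.graph := by
  simp only [mem_graph_iff]
  constructor
  · rintro ⟨⟨x', hx'⟩, rfl, rfl⟩
    obtain ⟨⟨w, hw, rfl⟩, hx2⟩ := hx'
    exact ⟨T w, ⟨w, rfl, rfl⟩, ⟨⟨T w, hw⟩, rfl, rfl⟩⟩
  · rintro ⟨z, ⟨w, rfl, rfl⟩, ⟨v, hv, rfl⟩⟩
    have hw : T w ∈ S.domain := hv ▸ v.2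
    refine ⟨⟨w, ⟨w, hw, rfl⟩, w.2⟩, rfl, ?_⟩
    change S ⟨T w, hw⟩ = S v
    congr 1
    exact Subtype.ext hv.symm

/-- The defining relation of the adjoint, in terms of graphs. -/
theorem inner_eq_of_mem_graph_adjoint {S : H →ₗ.[ℂ] H} (hS : Dense (S.domain : Set H))
    {x z a b : H} (hx : (x, z) ∈ S†.graph) (ha : (a, b) ∈ S.graph) :
    ⟪b, x⟫_ℂ = ⟪a, z⟫_ℂ := by
  rw [adjoint_graph_eq_graph_adjoint hS, Submodule.mem_adjoint_iff] at hx
  exact sub_eq_zero.1 (hx a b ha)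

theorem inner_pmul_adjoint_eq {S : H →ₗ.[ℂ] H} (hS : Dense (S.domain : Set H))
    {x z y : H} (hx : (x, z) ∈ S†.graph) (hz : (z, y) ∈ S.graph) :
    ⟪y, x⟫_ℂ = (‖z‖ : ℂ) ^ 2 := by
  rw [inner_eq_of_mem_graph_adjoint hS hx hz, inner_self_eq_norm_sq_to_K]
  rfl

/-- `S S*` is closed whenever `S` is closed and densely defined. -/
theorem IsClosed.pmul_adjoint {S : H →ₗ.[ℂ] H} (hS : Dense (S.domain : Set H))
    (hc : S.IsClosed) : (S.pmul S†).IsClosed := by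
  let G : Submodule ℂ (H × H × H) :=
    S†.graph.comap ((LinearMap.fst ℂ H (H × H)).prod
      (LinearMap.fst ℂ H H ∘ₗ LinearMap.snd ℂ H (H × H))) ⊓
    S.graph.comap (LinearMap.snd ℂ H (H × H))
  have hG : _root_.IsClosed (G : Set (H × H × H)) :=
    ((adjoint_isClosed hS).preimage
      (f := fun p : H × H × H => (p.1, p.2.1)) (by fun_prop)).inter
      (hc.preimage (f := fun p : H × H × H => p.2) (by fun_prop))
  have : CompleteSpace G := hG.completeSpace_coe
  let π : G →L[ℂ] H × H :=
    ((ContinuousLinearMap.fst ℂ H (H × H)).prod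
      (ContinuousLinearMap.snd ℂ H H ∘L ContinuousLinearMap.snd ℂ H (H × H))) ∘L G.subtypeL
  have hπ : AntilipschitzWith 1 π := by
    refine π.antilipschitz_of_bound ?_
    rintro ⟨⟨x, z, y⟩, hx, hz⟩
    have hin := inner_pmul_adjoint_eq hS (show (x, z) ∈ S†.graph from hx)
      (show (z, y) ∈ S.graph from hz)
    have hle : ‖z‖ ^ 2 ≤ ‖y‖ * ‖x‖ := by
      have h := norm_inner_le_norm (𝕜 := ℂ) y x
      rwa [hin, norm_pow, Complex.norm_real, norm_norm] at h
    change max ‖x‖ (max ‖z‖ ‖y‖) ≤ 1 * max ‖x‖ ‖y‖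
    rw [one_mul]
    refine max_le (le_max_left _ _) (max_le ?_ (le_max_right _ _))
    refine le_of_sq_le_sq ?_ (le_max_of_le_left (norm_nonneg x))
    calc ‖z‖ ^ 2 ≤ ‖y‖ * ‖x‖ := hle
      _ ≤ max ‖x‖ ‖y‖ * max ‖x‖ ‖y‖ := by
          gcongr
          · exact le_max_right _ _
          · exact le_max_left _ _
      _ = max ‖x‖ ‖y‖ ^ 2 := (sq _).symm
  have hr : ((S.pmul S†).graph : Set (H × H)) = Set.range π := by
    ext ⟨x, y⟩
    rw [SetLike.mem_coe, mem_graph_pmul_iff]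
    constructor
    · rintro ⟨z, hx, hz⟩
      exact ⟨⟨(x, z, y), hx, hz⟩, rfl⟩
    · rintro ⟨⟨⟨x', z, y'⟩, hx, hz⟩, h⟩
      obtain ⟨rfl, rfl⟩ := Prod.mk.inj h
      exact ⟨z, hx, hz⟩
  rw [LinearPMap.IsClosed, hr]
  exact hπ.isClosed_range π.uniformContinuous

/-- `1 + S* S` is surjective whenever `S` is closed and densely defined. -/
theorem IsClosed.exists_add_adjoint_pmul_eq {S : H →ₗ.[ℂ] H} (hS : Dense (S.domain : Set H))
    (hc : S.IsClosed) (h : H) : ∃ x y, (x, y) ∈ (S†.pmul S).graph ∧ x + y = h := by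
  let K : Submodule ℂ (WithLp 2 (H × H)) :=
    S.graph.comap (WithLp.linearEquiv 2 ℂ (H × H)).toLinearMap
  have hK : _root_.IsClosed (K : Set (WithLp 2 (H × H))) :=
    hc.preimage (WithLp.prod_continuous_ofLp 2 H H)
  have : CompleteSpace K := hK.completeSpace_coe
  obtain ⟨p, hp, q, hq, hpq⟩ := K.exists_add_mem_mem_orthogonal (WithLp.toLp 2 (h, (0 : H)))
  have h1 : h = p.fst + q.fst := congrArg WithLp.fst hpq
  have h2 : 0 = p.snd + q.snd := congrArg WithLp.snd hpq
  refine ⟨p.fst, q.fst, mem_graph_pmul_iff.2 ⟨p.snd, hp, ?_⟩, h1.symm⟩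
  rw [adjoint_graph_eq_graph_adjoint hS, Submodule.mem_adjoint_iff]
  intro a b hab
  have hort := (Submodule.mem_orthogonal _ _).1 hq (WithLp.toLp 2 (a, b)) hab
  rw [WithLp.prod_inner_apply] at hort
  have hort' : ⟪a, q.fst⟫_ℂ + ⟪b, q.snd⟫_ℂ = 0 := hort
  rw [eq_neg_of_add_eq_zero_left h2.symm, inner_neg_right]
  linear_combination -hort'

/-- `1 + S S*` is injective whenever `S` is densely defined. -/
theorem eq_zero_of_mem_graph_pmul_adjoint {S : H →ₗ.[ℂ] H} (hS : Dense (S.domain : Set H))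
    {x y : H} (hxy : (x, y) ∈ (S.pmul S†).graph) (h : x + y = 0) : x = 0 := by
  obtain ⟨z, hx, hz⟩ := mem_graph_pmul_iff.1 hxy
  have hin := inner_pmul_adjoint_eq hS hx hz
  rw [eq_neg_of_add_eq_zero_right h, inner_neg_left, inner_self_eq_norm_sq_to_K] at hin
  have hin' : -(‖x‖ : ℂ) ^ 2 = (‖z‖ : ℂ) ^ 2 := hin
  have hr : -‖x‖ ^ 2 = ‖z‖ ^ 2 := by exact_mod_cast hin'
  have : ‖x‖ ^ 2 = 0 := by nlinarith [sq_nonneg ‖x‖, sq_nonneg ‖z‖]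
  simpa using this

/-- For closed densely defined `S`, the inclusion `S* S ⊂ S S*` is already an equality. -/
theorem IsClosed.adjoint_pmul_eq_of_le {S : H →ₗ.[ℂ] H} (hS : Dense (S.domain : Set H))
    (hc : S.IsClosed) (hle : S†.pmul S ≤ S.pmul S†) : S†.pmul S = S.pmul S† := by
  refine le_antisymm hle (le_of_le_graph ?_)
  rintro ⟨x, y⟩ hxy
  obtain ⟨x', y', hxy', hadd⟩ := hc.exists_add_adjoint_pmul_eq hS (x + y)
  have hsub : (x - x', y - y') ∈ (S.pmul S†).graph :=
    Submodule.sub_mem _ hxy (le_graph_of_le hle hxy')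
  have hx : x = x' := sub_eq_zero.1 <| eq_zero_of_mem_graph_pmul_adjoint hS hsub <| by
    rw [sub_add_sub_comm, hadd, sub_self]
  subst hx
  rwa [add_left_cancel hadd] at hxy'

end LinearPMap

theorem statement1 (S T : H →ₗ.[ℂ] H)
    (hSdense : Dense (S.domain : Set H)) (hTdense : Dense (T.domain : Set H))
    (h1 : T ≤ S†.pmul S) (h2 : T ≤ S.pmul S†)
    (D : Submodule ℂ H) (hD : D ≤ T.domain) (hDdense : Dense (D : Set H))
    (hcore : (S†.pmul S).HasCore D) (hSclosed : S.IsClosed) :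
    S†.pmul S = S.pmul S† := by
  have hclosed := hSclosed.pmul_adjoint hSdense
  refine hSclosed.adjoint_pmul_eq_of_le hSdense (le_of_le_graph ?_)
  have hle : (S†.pmul S).domRestrict D ≤ S.pmul S† := by
    refine ⟨fun x hx => h2.1 (hD hx.1), fun x y hxy => ?_⟩
    let t : T.domain := ⟨x, hD x.2.1⟩
    have hA : T t = (S†.pmul S).domRestrict D x := h1.2 (y := ⟨x, x.2.2⟩) rfl
    have hB : T t = S.pmul S† y := h2.2 hxy
    exact hA.symm.trans hB
  rw [← hcore.closure_eq,
    ← (hclosed.isClosable.leIsClosable hle).graph_closure_eq_closure_graph]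
  exact Submodule.topologicalClosure_minimal _ (le_graph_of_le hle) hclosed
end

section
/- Let A and B be densely defined symmetric operators on a complex Hilbert space H, and let D be a dense linear subspace contained in D((A+B)²), where A+B has domain D(A) ∩ D(B). If D is a core for (A+B)* (A+B)‾ (the product of the adjoint of A+B with the closure of A+B), then A+B is essentially self-adjoint, i.e., the closure of A+B is self-adjoint. -/
open LinearPMap
open scoped InnerProductSpace

variable {H : Type*} [NormedAddCommGroup H] [InnerProductSpace ℂ H] [CompleteSpace H]

/-- The adjoint relation of a subspace only depends on its closure. -/
theorem Submodule.adjoint_topologicalClosure {E : Type*} [NormedAddCommGroup E]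
    [InnerProductSpace ℂ E] (g : Submodule ℂ (E × E)) :
    g.topologicalClosure.adjoint = g.adjoint := by
  ext ⟨y, z⟩
  simp only [Submodule.mem_adjoint_iff]
  refine ⟨fun h a b hab => h a b (g.le_topologicalClosure hab), fun h a b hab => ?_⟩
  have hclosed : IsClosed {p : E × E | inner ℂ p.2 y - inner ℂ p.1 z = 0} :=
    isClosed_eq (by fun_prop) continuous_const
  exact closure_minimal (fun p hp => h p.1 p.2 hp) hclosed hab

/-- Orthogonal decomposition of a vector of `H × H` along a closed subspace, with respect to the
Hilbert sum inner product. -/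
theorem Submodule.exists_mem_inner_add_inner_eq_zero {g : Submodule ℂ (H × H)}
    (hg : IsClosed (g : Set (H × H))) (y z : H) :
    ∃ p ∈ g, ∀ q ∈ g, inner ℂ q.1 (y - p.1) + inner ℂ q.2 (z - p.2) = 0 := by
  let K : Submodule ℂ (WithLp 2 (H × H)) :=
    g.comap (WithLp.linearEquiv 2 ℂ (H × H)).toLinearMap
  have hK : IsClosed (K : Set (WithLp 2 (H × H))) :=
    hg.preimage (WithLp.prod_continuous_ofLp 2 H H)
  have : CompleteSpace K := hK.completeSpace_coe
  refine ⟨(K.starProjection (WithLp.toLp 2 (y, z))).ofLp, K.starProjection_apply_mem _,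
    fun q hq => ?_⟩
  have h := (K.mem_orthogonal _).1
    (K.sub_starProjection_mem_orthogonal (WithLp.toLp 2 (y, z))) (WithLp.toLp 2 q) hq
  rwa [WithLp.prod_inner_apply] at h

namespace LinearPMap

theorem closure_graph_le {E : Type*} [NormedAddCommGroup E] [InnerProductSpace ℂ E]
    (f : E →ₗ.[ℂ] E) : f.closure.graph ≤ f.graph.topologicalClosure := by
  by_cases hf : f.IsClosable
  · exact hf.graph_closure_eq_closure_graph.ge
  · rw [closure_def' hf]
    exact f.graph.le_topologicalClosure

theorem mem_pmul_graph_iff {E : Type*} [NormedAddCommGroup E] [InnerProductSpace ℂ E]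
    {S T : E →ₗ.[ℂ] E} {x z : E} :
    (x, z) ∈ (S.pmul T).graph ↔ ∃ y, (x, y) ∈ T.graph ∧ (y, z) ∈ S.graph := by
  have key : ∀ (w : (S.pmul T).domain) (v : T.domain), (w : E) = v →
      ∀ hv : T v ∈ S.domain, S.pmul T w = S ⟨T v, hv⟩ := by
    intro w v hwv hv
    have h : T.domRestrict _ w = T v := LinearPMap.domRestrict_apply hwv
    exact congrArg S.toFun (Subtype.ext h)
  constructor
  · intro h
    obtain ⟨w, rfl, rfl⟩ := (mem_graph_iff _).1 h
    obtain ⟨v, hv, hvw⟩ := w.2.1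
    refine ⟨T v, ?_, ?_⟩
    · rw [← hvw]
      exact T.mem_graph v
    · rw [key w v hvw.symm hv]
      exact S.mem_graph ⟨T v, hv⟩
  · rintro ⟨y, hxy, hyz⟩
    obtain ⟨v, rfl, rfl⟩ := (mem_graph_iff _).1 hxy
    obtain ⟨u, hu, rfl⟩ := (mem_graph_iff _).1 hyz
    have hv : T v ∈ S.domain := mem_domain_of_mem_graph hyz
    have hw : (v : E) ∈ (S.pmul T).domain := ⟨⟨v, hv, rfl⟩, v.2⟩
    refine (mem_graph_iff _).2 ⟨⟨v, hw⟩, rfl, ?_⟩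
    rw [key ⟨v, hw⟩ v rfl hv]
    exact congrArg S.toFun (Subtype.ext hu.symm)

theorem mem_adjoint_graph_iff {T : H →ₗ.[ℂ] H} (hT : Dense (T.domain : Set H)) {y z : H} :
    (y, z) ∈ T†.graph ↔ ∀ a b, (a, b) ∈ T.graph → inner ℂ b y = inner ℂ a z := by
  simp only [adjoint_graph_eq_graph_adjoint hT, Submodule.mem_adjoint_iff, sub_eq_zero]

theorem adjoint_closure {T : H →ₗ.[ℂ] H} (hT : Dense (T.domain : Set H)) (hc : T.IsClosable) :
    T.closure† = T† := by
  apply eq_of_eq_graph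
  rw [adjoint_graph_eq_graph_adjoint hT,
    adjoint_graph_eq_graph_adjoint (hT.mono T.le_closure.1),
    ← hc.graph_closure_eq_closure_graph, Submodule.adjoint_topologicalClosure]

theorem add_le_adjoint_add {A B : H →ₗ.[ℂ] H} (hA : Dense (A.domain : Set H))
    (hB : Dense (B.domain : Set H)) (hAB : Dense ((A + B).domain : Set H))
    (hAsymm : A ≤ A†) (hBsymm : B ≤ B†) : A + B ≤ (A + B)† := by
  have symm : ∀ {C : H →ₗ.[ℂ] H}, Dense (C.domain : Set H) → C ≤ C† →
      ∀ x y : C.domain, inner ℂ (C x) (y : H) = inner ℂ (x : H) (C y) := by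
    intro C hC hCs x y
    rw [hCs.2 (y := ⟨x, hCs.1 x.2⟩) rfl]
    exact adjoint_isFormalAdjoint hC _ y
  refine IsFormalAdjoint.le_adjoint hAB fun x y => ?_
  rw [add_apply, add_apply, inner_add_left, inner_add_right]
  exact congrArg₂ (· + ·) (symm hA hAsymm ⟨x, x.2.1⟩ ⟨y, y.2.1⟩)
    (symm hB hBsymm ⟨x, x.2.2⟩ ⟨y, y.2.2⟩)

/-- If `D` is a core of `T* T̄`, then the range of `1 + T* T̄` on `D` has trivial orthogonal
complement. -/
theorem eq_zero_of_hasCore_adjoint_pmul_closure {T : H →ₗ.[ℂ] H}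
    (hT : Dense (T.domain : Set H)) (hc : T.IsClosable) {D : Submodule ℂ H}
    (hcore : (T†.pmul T.closure).HasCore D) {a : H}
    (ha : ∀ d ∈ D, ∀ e, (d, e) ∈ (T†.pmul T.closure).graph → inner ℂ (d + e) a = 0) :
    a = 0 := by
  obtain ⟨⟨x, w⟩, hxw, hp⟩ :=
    Submodule.exists_mem_inner_add_inner_eq_zero hc.closure_isClosed a 0
  have hP : (x, a - x) ∈ (T†.pmul T.closure).graph := by
    refine mem_pmul_graph_iff.2 ⟨w, hxw, (mem_adjoint_graph_iff hT).2 fun u v huv => ?_⟩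
    have h := hp (u, v) (le_graph_of_le T.le_closure huv)
    simp only [zero_sub, inner_neg_right] at h
    linear_combination -h
  have hsub : ((T†.pmul T.closure).domRestrict D).graph ≤
      (T†.pmul T.closure).graph := le_graph_of_le domRestrict_le
  rw [← hcore.closure_eq] at hP
  have hle : ∀ {p : H × H}, p ∈ ((T†.pmul T.closure).domRestrict D).graph → p.1 ∈ D :=
    fun hp => (mem_domain_of_mem_graph hp : _ ∈ D ⊓ (T†.pmul T.closure).domain).1
  have hclosed : _root_.IsClosed {p : H × H | inner ℂ (p.1 + p.2) a = 0} :=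
    isClosed_eq (by fun_prop) continuous_const
  have h : inner ℂ (x + (a - x)) a = 0 := closure_minimal
    (fun p hp => ha p.1 (hle hp) p.2 (hsub hp)) hclosed
    (closure_graph_le _ hP)
  rwa [add_sub_cancel, inner_self_eq_zero] at h

theorem isSelfAdjoint_closure_of_hasCore {T : H →ₗ.[ℂ] H} (hT : Dense (T.domain : Set H))
    (hsymm : T ≤ T†) {D : Submodule ℂ H} (hD : D ≤ (T.pmul T).domain)
    (hcore : (T†.pmul T.closure).HasCore D) : IsSelfAdjoint T.closure := by
  have hadj : T†.IsClosed := adjoint_isClosed hT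
  have hc : T.IsClosable := hadj.isClosable.leIsClosable hsymm
  rw [isSelfAdjoint_def, adjoint_closure hT hc]
  refine le_antisymm (le_of_le_graph ?_) (le_of_le_graph ?_)
  · rintro ⟨y, z⟩ hyz
    obtain ⟨⟨x, w⟩, hxw, hp⟩ :=
      Submodule.exists_mem_inner_add_inner_eq_zero hc.closure_isClosed y z
    have hxw' : (x, w) ∈ T†.graph :=
      closure_minimal (le_graph_of_le hsymm) hadj (closure_graph_le T hxw)
    have hp' : ∀ u v, (u, v) ∈ T.graph → inner ℂ u (y - x) + inner ℂ v (z - w) = 0 :=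
      fun u v huv => hp (u, v) (le_graph_of_le T.le_closure huv)
    have hdiff : ∀ u v, (u, v) ∈ T.graph → inner ℂ v (y - x) = inner ℂ u (z - w) :=
      (mem_adjoint_graph_iff hT).1 (sub_mem hyz hxw')
    have hyx : y - x = 0 := by
      refine eq_zero_of_hasCore_adjoint_pmul_closure hT hc hcore fun d hd e hde => ?_
      obtain ⟨e', he'⟩ := mem_domain_iff.1 (hD hd)
      obtain ⟨f, hdf, hfe'⟩ := mem_pmul_graph_iff.1 he'
      obtain rfl : e' = e := mem_graph_snd_inj _ (mem_pmul_graph_iff.2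
        ⟨f, le_graph_of_le T.le_closure hdf, le_graph_of_le hsymm hfe'⟩) hde rfl
      rw [inner_add_left, hdiff _ _ hfe']
      exact hp' d f hdf
    have hzw : z - w = 0 := by
      refine hT.eq_zero_of_inner_right ℂ fun u hu => ?_
      have h := hdiff _ _ (T.mem_graph ⟨u, hu⟩)
      rwa [hyx, inner_zero_right, eq_comm] at h
    rwa [sub_eq_zero.1 hyx, sub_eq_zero.1 hzw]
  · exact (closure_graph_le T).trans
      (Submodule.topologicalClosure_minimal _ (le_graph_of_le hsymm) hadj)

end LinearPMap

theorem statement4 (A B : H →ₗ.[ℂ] H)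
    (hAdense : Dense (A.domain : Set H)) (hBdense : Dense (B.domain : Set H))
    (hAsymm : A ≤ A†) (hBsymm : B ≤ B†)
    (D : Submodule ℂ H) (hDdense : Dense (D : Set H))
    (hD : D ≤ ((A + B).pmul (A + B)).domain)
    (hcore : ((A + B)†.pmul (A + B).closure).HasCore D) :
    (A + B).IsClosable ∧ IsSelfAdjoint (A + B).closure := by
  have hdom : Dense ((A + B).domain : Set H) :=
    hDdense.mono fun _ hx => (hD hx).2
  have hsymm : A + B ≤ (A + B)† := add_le_adjoint_add hAdense hBdense hdom hAsymm hBsymm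
  exact ⟨(adjoint_isClosed hdom).isClosable.leIsClosable hsymm,
    isSelfAdjoint_closure_of_hasCore hdom hsymm hD hcore⟩
end

section
/- Let A and B be densely defined operators on a complex Hilbert space H. Assume A is invertible with inverse A⁻¹ an everywhere-defined bounded operator on H (so A is a bijection from D(A) onto H with bounded inverse). Then (BA)* = A*B*, where BA has domain {x ∈ D(A) : Ax ∈ D(B)}. -/
open LinearPMap
open scoped InnerProductSpace

variable {H : Type*} [NormedAddCommGroup H] [InnerProductSpace ℂ H] [CompleteSpace H]

theorem LinearPMap.mk_mem_graph_pmul_iff (S T : H →ₗ.[ℂ] H) (x z : H) :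
    (x, z) ∈ (S.pmul T).graph ↔ ∃ y, (x, y) ∈ T.graph ∧ (y, z) ∈ S.graph := by
  simp only [mem_graph_iff]
  constructor
  · rintro ⟨u, hu, hz⟩
    obtain ⟨v, hv, hvu⟩ := u.2.1
    refine ⟨T v, ⟨v, hvu.trans hu, rfl⟩, ⟨T v, hv⟩, rfl, ?_⟩
    rw [← hz]
    refine congrArg S (Subtype.ext ?_)
    exact (LinearPMap.domRestrict_apply hvu.symm).symm
  · rintro ⟨y, ⟨v, hv, hy⟩, w, hw, hz⟩
    have hvw : T v = w := hy.trans hw.symm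
    have hdom : T v ∈ S.domain := hvw ▸ w.2
    refine ⟨⟨x, ⟨v, hdom, hv⟩, hv ▸ v.2⟩, rfl, ?_⟩
    rw [← hz]
    refine congrArg S (Subtype.ext ?_)
    exact (LinearPMap.domRestrict_apply hv.symm).trans hvw

theorem LinearPMap.mk_mem_graph_adjoint_iff {T : H →ₗ.[ℂ] H} (hT : Dense (T.domain : Set H))
    (y w : H) :
    (y, w) ∈ T†.graph ↔ ∀ x z, (x, z) ∈ T.graph → ⟪w, x⟫_ℂ = ⟪y, z⟫_ℂ := by
  constructor
  · intro h x z hxz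
    obtain ⟨u, rfl, rfl⟩ := (mem_graph_iff _).1 h
    obtain ⟨v, rfl, rfl⟩ := (mem_graph_iff _).1 hxz
    exact adjoint_isFormalAdjoint hT u v
  · intro h
    have h' : ∀ x : T.domain, ⟪w, x⟫_ℂ = ⟪y, T x⟫_ℂ := fun x => h _ _ (T.mem_graph x)
    exact (mem_graph_iff _).2
      ⟨⟨y, mem_adjoint_domain_of_exists y ⟨w, h'⟩⟩, rfl, adjoint_apply_eq hT _ h'⟩

theorem statement9 (A B : H →ₗ.[ℂ] H)
    (hAdense : Dense (A.domain : Set H)) (hBdense : Dense (B.domain : Set H))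
    (C : H →L[ℂ] H) (hCA : ∀ x : A.domain, C (A x) = (x : H))
    (hAC : ∀ y : H, ∃ h : C y ∈ A.domain, A ⟨C y, h⟩ = y) :
    (B.pmul A)† = A†.pmul B† := by
  have hA (y : H) : (C y, y) ∈ A.graph := (mem_graph_iff _).2 ⟨_, rfl, (hAC y).2⟩
  have hBA (b : B.domain) : (C b, B b) ∈ (B.pmul A).graph :=
    (mk_mem_graph_pmul_iff _ _ _ _).2 ⟨b, hA b, B.mem_graph b⟩
  have hrange : DenseRange C := hAdense.mono fun x hx => ⟨_, hCA ⟨x, hx⟩⟩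
  have hdense : Dense ((B.pmul A).domain : Set H) := by
    refine (hrange.dense_image C.continuous hBdense).mono ?_
    rintro _ ⟨b, hb, rfl⟩
    exact mem_domain_of_mem_graph (hBA ⟨b, hb⟩)
  refine eq_of_eq_graph (Submodule.ext ?_)
  rintro ⟨y, w⟩
  rw [mk_mem_graph_pmul_iff, mk_mem_graph_adjoint_iff hdense]
  simp only [mk_mem_graph_adjoint_iff hAdense, mk_mem_graph_adjoint_iff hBdense]
  constructor
  · intro h
    refine ⟨C.adjoint w, fun x z hxz => ?_, fun x z hxz => ?_⟩
    · obtain ⟨b, rfl, rfl⟩ := (mem_graph_iff _).1 hxz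
      rw [ContinuousLinearMap.adjoint_inner_left]
      exact h _ _ (hBA b)
    · obtain ⟨a, rfl, rfl⟩ := (mem_graph_iff _).1 hxz
      rw [ContinuousLinearMap.adjoint_inner_left, hCA]
  · rintro ⟨v, hB, hA'⟩ x z hxz
    obtain ⟨u, hxu, huz⟩ := (mk_mem_graph_pmul_iff _ _ _ _).1 hxz
    exact (hA' x u hxu).trans (hB u z huz)
end

section
/- Let A be a densely defined normal operator on a complex Hilbert space H with domain D(A), and let B be an everywhere-defined bounded self-adjoint operator on H satisfying BA* ⊂ −AB (for every x ∈ D(A*): Bx ∈ D(A) and BA*x = −ABx). Then D(A*(A+B)) = D(A*A) and D(A(A*+B)) = D(AA*), and moreover A*(A+B) = A*A + A*B and A(A*+B) = AA* + AB as operators. -/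
open LinearPMap
open scoped InnerProductSpace

variable {H : Type*} [NormedAddCommGroup H] [InnerProductSpace ℂ H] [CompleteSpace H]

theorem LinearPMap.mem_pmul_domain {S T : H →ₗ.[ℂ] H} {x : H} :
    x ∈ (S.pmul T).domain ↔ ∃ h : x ∈ T.domain, T ⟨x, h⟩ ∈ S.domain := by
  constructor
  · rintro ⟨⟨y, hy, rfl⟩, -⟩
    exact ⟨y.2, hy⟩
  · rintro ⟨h, hS⟩
    exact ⟨⟨⟨x, h⟩, hS, rfl⟩, h⟩

/-- For a closed densely defined operator `A`, the operator `1 + A* A` is surjective. -/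
theorem LinearPMap.IsClosed.exists_add_adjoint_apply_eq {A : H →ₗ.[ℂ] H} (hA : A.IsClosed)
    (hd : Dense (A.domain : Set H)) (v : H) :
    ∃ (y : A.domain) (hy : A y ∈ A†.domain), (y : H) + A† ⟨A y, hy⟩ = v := by
  let G : Submodule ℂ (WithLp 2 (H × H)) :=
    A.graph.comap (WithLp.linearEquiv 2 ℂ (H × H)).toLinearMap
  have hG : _root_.IsClosed (G : Set (WithLp 2 (H × H))) :=
    hA.preimage (WithLp.prod_continuous_ofLp 2 H H)
  have : CompleteSpace G := hG.completeSpace_coe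
  obtain ⟨g, hg, g', hg', he⟩ := G.exists_add_mem_mem_orthogonal (WithLp.toLp 2 (v, 0))
  obtain ⟨y, hy1, hy2⟩ := (LinearPMap.mem_graph_iff A).1 (Submodule.mem_comap.1 hg)
  have h1 : g.fst + g'.fst = v := (congrArg WithLp.fst he).symm
  have h2 : g.snd + g'.snd = 0 := (congrArg WithLp.snd he).symm
  have hy1 : (y : H) = g.fst := hy1
  have hy2 : A y = g.snd := hy2
  have key : ∀ z : A.domain, ⟪v - y, (z : H)⟫_ℂ = ⟪A y, A z⟫_ℂ := by
    intro z
    have h := (Submodule.mem_orthogonal' G g').1 hg' (WithLp.toLp 2 ((z : H), A z))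
      (Submodule.mem_comap.2 (A.mem_graph z))
    rw [WithLp.prod_inner_apply] at h
    have e1 : v - y = g'.fst := by rw [hy1, ← h1]; abel
    have e2 : A y = - g'.snd := by rw [hy2]; exact eq_neg_of_add_eq_zero_left h2
    rw [e1, e2, inner_neg_left]
    exact eq_neg_of_add_eq_zero_left h
  refine ⟨y, mem_adjoint_domain_of_exists _ ⟨v - y, key⟩, ?_⟩
  rw [adjoint_apply_eq hd _ (x₀ := v - y) key]
  abel

/-- For a closed densely defined operator `A`, the domain of `A* A` is a core for `A`. -/
theorem LinearPMap.IsClosed.exists_seq_tendsto_graph {A : H →ₗ.[ℂ] H} (hA : A.IsClosed)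
    (hd : Dense (A.domain : Set H)) (x : A.domain) :
    ∃ u : ℕ → A.domain, (∀ n, A (u n) ∈ A†.domain) ∧
      Filter.Tendsto (fun n => (u n : H)) Filter.atTop (nhds x) ∧
      Filter.Tendsto (fun n => A (u n)) Filter.atTop (nhds (A x)) := by
  let G : Submodule ℂ (WithLp 2 (H × H)) :=
    A.graph.comap (WithLp.linearEquiv 2 ℂ (H × H)).toLinearMap
  have hG : _root_.IsClosed (G : Set (WithLp 2 (H × H))) :=
    hA.preimage (WithLp.prod_continuous_ofLp 2 H H)
  let S : Submodule ℂ (WithLp 2 (H × H)) :=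
    G ⊓ A†.domain.comap ((LinearMap.snd ℂ H H).comp
      (WithLp.linearEquiv 2 ℂ (H × H)).toLinearMap)
  have hSG : S.topologicalClosure ≤ G := S.topologicalClosure_minimal inf_le_left hG
  have : CompleteSpace S.topologicalClosure :=
    S.isClosed_topologicalClosure.completeSpace_coe
  have hperp : S.topologicalClosureᗮ ⊓ G = ⊥ := by
    rw [eq_bot_iff]
    rintro w ⟨hw, hwG⟩
    obtain ⟨y, hy1, hy2⟩ := (LinearPMap.mem_graph_iff A).1 (Submodule.mem_comap.1 hwG)
    have hy1 : (y : H) = w.fst := hy1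
    have hy2 : A y = w.snd := hy2
    obtain ⟨z, hz, hzy⟩ := hA.exists_add_adjoint_apply_eq hd (y : H)
    have h := (Submodule.mem_orthogonal _ w).1 hw (WithLp.toLp 2 ((z : H), A z))
      (S.le_topologicalClosure ⟨Submodule.mem_comap.2 (A.mem_graph z), hz⟩)
    rw [WithLp.prod_inner_apply] at h
    have h : ⟪(z : H), w.fst⟫_ℂ + ⟪A z, w.snd⟫_ℂ = 0 := h
    rw [← hy1, ← hy2] at h
    have hadj : ⟪A† ⟨A z, hz⟩, (y : H)⟫_ℂ = ⟪A z, A y⟫_ℂ :=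
      adjoint_isFormalAdjoint hd ⟨A z, hz⟩ y
    rw [← hadj, ← inner_add_left, hzy, inner_self_eq_zero] at h
    have hy0 : y = 0 := Subtype.ext h
    rw [Submodule.mem_bot]
    apply WithLp.ofLp_injective 2
    refine Prod.ext (hy1.symm.trans h) (hy2.symm.trans ?_)
    rw [hy0, LinearPMap.map_zero]; rfl
  have hcl : S.topologicalClosure = G := by
    have h := Submodule.sup_orthogonal_inf_of_hasOrthogonalProjection hSG
    rwa [hperp, sup_bot_eq] at h
  have hx : WithLp.toLp 2 ((x : H), A x) ∈ _root_.closure (S : Set (WithLp 2 (H × H))) := by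
    rw [← Submodule.topologicalClosure_coe, hcl]
    exact A.mem_graph x
  obtain ⟨p, hp, hlim⟩ := mem_closure_iff_seq_limit.1 hx
  choose u hu1 hu2 using fun n => (LinearPMap.mem_graph_iff A).1 (Submodule.mem_comap.1 (hp n).1)
  have hlim' := ((WithLp.prod_continuous_ofLp 2 H H).tendsto _).comp hlim
  refine ⟨u, fun n => ?_, ?_, ?_⟩
  · rw [hu2 n]; exact (hp n).2
  · simp_rw [hu1]; exact (continuous_fst.tendsto _).comp hlim'
  · simp_rw [hu2]; exact (continuous_snd.tendsto _).comp hlim'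

theorem LinearPMap.IsNormalOp.mem_adjoint_domain_of_apply_mem {A : H →ₗ.[ℂ] H}
    (hA : A.IsNormalOp) (y : A.domain) (hy : A y ∈ A†.domain) :
    ∃ h : (y : H) ∈ A†.domain, ‖A† ⟨y, h⟩‖ = ‖A y‖ := by
  have hm : (y : H) ∈ (A†.pmul A).domain := mem_pmul_domain.2 ⟨y.2, hy⟩
  have hm' : (y : H) ∈ (A.pmul A†).domain := hA.adjoint_mul_comm ▸ hm
  obtain ⟨h, h'⟩ := mem_pmul_domain.1 hm'
  refine ⟨h, ?_⟩
  have heq : A† ⟨A y, hy⟩ = A ⟨A† ⟨y, h⟩, h'⟩ :=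
    (le_of_eq hA.adjoint_mul_comm).2 (x := ⟨y, hm⟩) (y := ⟨y, hm'⟩) rfl
  have e1 : ⟪A† ⟨A y, hy⟩, (y : H)⟫_ℂ = ⟪A y, A y⟫_ℂ :=
    adjoint_isFormalAdjoint hA.dense ⟨A y, hy⟩ y
  have e2 : ⟪A ⟨A† ⟨y, h⟩, h'⟩, (y : H)⟫_ℂ = ⟪A† ⟨y, h⟩, A† ⟨y, h⟩⟫_ℂ :=
    (adjoint_isFormalAdjoint hA.dense).symm ⟨A† ⟨y, h⟩, h'⟩ ⟨y, h⟩
  rw [heq, e2, inner_self_eq_norm_sq_to_K, inner_self_eq_norm_sq_to_K] at e1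
  exact (sq_eq_sq₀ (norm_nonneg _) (norm_nonneg _)).1 (by exact_mod_cast e1)

theorem LinearPMap.IsNormalOp.domain_le_adjoint_domain {A : H →ₗ.[ℂ] H} (hA : A.IsNormalOp) :
    A.domain ≤ A†.domain := by
  intro x hx
  obtain ⟨u, hu, hlim, hlimA⟩ := hA.isClosed.exists_seq_tendsto_graph hA.dense ⟨x, hx⟩
  choose h hnorm using fun n => hA.mem_adjoint_domain_of_apply_mem (u n) (hu n)
  have hdist : ∀ m n, dist (A† ⟨u m, h m⟩) (A† ⟨u n, h n⟩) = dist (A (u m)) (A (u n)) := by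
    intro m n
    have hmem : A (u m - u n) ∈ A†.domain := by
      rw [LinearPMap.map_sub]; exact sub_mem (hu m) (hu n)
    obtain ⟨h', hn⟩ := hA.mem_adjoint_domain_of_apply_mem (u m - u n) hmem
    rw [dist_eq_norm, dist_eq_norm, ← LinearPMap.map_sub, ← LinearPMap.map_sub, ← hn]
    rfl
  have hc : CauchySeq fun n => A† ⟨u n, h n⟩ := by
    rw [Metric.cauchySeq_iff]
    simp_rw [hdist]
    exact Metric.cauchySeq_iff.1 hlimA.cauchySeq
  obtain ⟨w, hw⟩ := cauchySeq_tendsto_of_complete hc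
  have hgr : (x, w) ∈ (A†.graph : Set (H × H)) :=
    (adjoint_isClosed hA.dense).mem_of_tendsto (hlim.prodMk_nhds hw)
      (Filter.Eventually.of_forall fun n => A†.mem_graph ⟨u n, h n⟩)
  exact LinearPMap.mem_domain_of_mem_graph hgr

/-- Left distributivity of the product over the addition of a bounded operator mapping the domain
of `T` into that of `S`. -/
theorem LinearPMap.pmul_add_toPMap (S T : H →ₗ.[ℂ] H) (B : H →ₗ[ℂ] H)
    (hB : ∀ x ∈ T.domain, B x ∈ S.domain) :
    (S.pmul (T + B.toPMap ⊤)).domain = (S.pmul T).domain ∧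
      S.pmul (T + B.toPMap ⊤) = S.pmul T + S.pmul (B.toPMap ⊤) := by
  have hdom : (S.pmul (T + B.toPMap ⊤)).domain = (S.pmul T).domain := by
    ext x
    rw [mem_pmul_domain, mem_pmul_domain]
    constructor
    · rintro ⟨h, hS⟩
      refine ⟨h.1, ?_⟩
      have hS : T ⟨x, h.1⟩ + B x ∈ S.domain := hS
      exact (Submodule.add_mem_iff_left _ (hB x h.1)).1 hS
    · rintro ⟨h, hS⟩
      exact ⟨⟨h, trivial⟩, add_mem hS (hB x h)⟩
  refine ⟨hdom, LinearPMap.ext ?_ ?_⟩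
  · rw [hdom, LinearPMap.add_domain, eq_comm, inf_eq_left]
    intro x hx
    obtain ⟨h, -⟩ := mem_pmul_domain.1 hx
    exact mem_pmul_domain.2 ⟨trivial, hB x h⟩
  · intro x hx hx'
    obtain ⟨h, hS⟩ := mem_pmul_domain.1 hx'.1
    exact S.map_add ⟨T ⟨x, h⟩, hS⟩ ⟨B x, hB x h⟩

theorem statement11 (A : H →ₗ.[ℂ] H) (hA : A.IsNormalOp)
    (B : H →L[ℂ] H) (hB : ∀ x y : H, ⟪B x, y⟫_ℂ = ⟪x, B y⟫_ℂ)
    (hanti : ∀ x : A†.domain, ∃ h : B (x : H) ∈ A.domain,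
      B (A† x) = - A ⟨B (x : H), h⟩) :
    (A†.pmul (A + (B : H →ₗ[ℂ] H).toPMap ⊤)).domain = (A†.pmul A).domain ∧
    (A.pmul (A† + (B : H →ₗ[ℂ] H).toPMap ⊤)).domain = (A.pmul A†).domain ∧
    A†.pmul (A + (B : H →ₗ[ℂ] H).toPMap ⊤) =
      A†.pmul A + A†.pmul ((B : H →ₗ[ℂ] H).toPMap ⊤) ∧
    A.pmul (A† + (B : H →ₗ[ℂ] H).toPMap ⊤) =
      A.pmul A† + A.pmul ((B : H →ₗ[ℂ] H).toPMap ⊤) := by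
  have hle := hA.domain_le_adjoint_domain
  have hmap : ∀ x ∈ A†.domain, B x ∈ A.domain := fun x hx => (hanti ⟨x, hx⟩).1
  obtain ⟨hd, he⟩ := A†.pmul_add_toPMap A (B : H →ₗ[ℂ] H) fun x hx => hle (hmap x (hle hx))
  obtain ⟨hd', he'⟩ := A.pmul_add_toPMap A† (B : H →ₗ[ℂ] H) hmap
  exact ⟨hd, hd', he, he'⟩
end
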